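/- For every t ≥ 3 there exist a finite set X, a set 𝒯 of t rooted binary phylogenetic trees on X, and a common m-chain C' = (x_1,…,x_m) of 𝒯 with m = 2(t+2), such that every rooted agreement forest for 𝒯 has size at least t, while the set of trees obtained by truncating C' to length t−2 (restricting each T ∈ 𝒯 to X ∖ {x_{t−1},…,x_m}) has a rooted agreement forest of size at most t−1. (Hence in the rooted setting truncating common chains to length min{max{k,3}, t−2} is not safe for parameter k = t−1.) -/

import Mathlib

/-- A rooted binary phylogenetic tree on taxon set `X`: a finite directed tree with all
edges directed away from the root, whose root has in-degree 0 (and out-degree 2 unless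
it is itself the unique leaf), whose leaves (out-degree 0) are bijectively labelled by
`X`, and whose remaining vertices have in-degree 1 and out-degree 2. -/
structure RTree (X : Type) : Type 1 where
  V : Type
  finV : Finite V
  E : V → V → Prop
  root : V
  label : X → V
  label_inj : Function.Injective label
  reach_root : ∀ v : V, Relation.ReflTransGen E root v
  not_into_root : ∀ u : V, ¬ E u root
  leaf_iff : ∀ v : V, {w : V | E v w} = ∅ ↔ v ∈ Set.range label
  out_two : ∀ v : V, v ∉ Set.range label → {w : V | E v w}.ncard = 2
  in_one : ∀ v : V, v ≠ root → {u : V | E u v}.ncard = 1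

namespace RTree

variable {X : Type}

/-- `u` is an ancestor of (or equal to) `v`. -/
def anc (T : RTree X) (u v : T.V) : Prop := Relation.ReflTransGen T.E u v

/-- Vertex set of the minimal subtree `T[B]` of `T` spanning the leaves labelled by `B`:
the vertices that are ancestors of some leaf in `B` and descendants of every common
ancestor of all leaves in `B`. -/
def spanSet (T : RTree X) (B : Set X) : Set T.V :=
  {v | (∃ x ∈ B, T.anc v (T.label x)) ∧
    ∀ w : T.V, (∀ x ∈ B, T.anc w (T.label x)) → T.anc w v}

/-- `deg^T(B)`: the number of edges of `T` with exactly one endpoint in `T[B]`. -/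
noncomputable def blockDeg (T : RTree X) (B : Set X) : ℕ :=
  {p : T.V × T.V | T.E p.1 p.2 ∧
    Xor' (p.1 ∈ T.spanSet B) (p.2 ∈ T.spanSet B)}.ncard

/-- The vertices of `T[B]` surviving the suppression of in-degree-1 out-degree-1
vertices: the leaves labelled by `B` together with the branch points of `T[B]`. -/
def keepSet (T : RTree X) (B : Set X) : Set T.V :=
  {v | v ∈ T.spanSet B ∧
    (v ∈ T.label '' B ∨ 2 ≤ ({w : T.V | T.E v w} ∩ T.spanSet B).ncard)}

/-- Adjacency in the suppressed tree `T|B`: `v` is reachable from `u` by a directed path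
inside `T[B]` containing no other surviving vertex internally. -/
def restAdj (T : RTree X) (B : Set X) (u v : T.V) : Prop :=
  u ∈ T.keepSet B ∧ v ∈ T.keepSet B ∧ u ≠ v ∧
    Relation.ReflTransGen
      (fun a b => T.E a b ∧ b ∈ T.spanSet B ∧ (b = v ∨ b ∉ T.keepSet B)) u v

/-- `T|B = T'|B`: a leaf-label-preserving isomorphism between the suppressed trees
respecting edge directions. -/
def restEq (T T' : RTree X) (B : Set X) : Prop :=
  ∃ φ : T.V → T'.V, Set.BijOn φ (T.keepSet B) (T'.keepSet B) ∧
    (∀ x ∈ B, φ (T.label x) = T'.label x) ∧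
    ∀ u v : T.V, u ∈ T.keepSet B → v ∈ T.keepSet B →
      (T.restAdj B u v ↔ T'.restAdj B (φ u) (φ v))

/-- `F` is a partition of `X` into nonempty blocks. -/
def IsForestPartition (F : Set (Set X)) : Prop :=
  (∀ B ∈ F, B.Nonempty) ∧ ∀ x : X, ∃! B, B ∈ F ∧ x ∈ B

/-- A rooted agreement forest for `𝒯`: a partition of `X` whose blocks have a common
topology in all trees and induce pairwise vertex-disjoint subtrees in each tree. -/
def IsAgreementForest (𝒯 : Set (RTree X)) (F : Set (Set X)) : Prop :=
  IsForestPartition F ∧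
  (∀ B ∈ F, ∀ T ∈ 𝒯, ∀ T' ∈ 𝒯, restEq T T' B) ∧
  ∀ B ∈ F, ∀ B' ∈ F, B ≠ B' → ∀ T ∈ 𝒯, Disjoint (T.spanSet B) (T.spanSet B')

/-- `(x 0, …, x (m-1))` is a chain in the rooted tree `T`, with `x 0` closest to the
root: the parent of each `x i` is equal to, or the parent of, the parent of `x (i+1)`. -/
def IsChainIn (T : RTree X) {m : ℕ} (x : Fin m → X) : Prop :=
  ∀ (i : ℕ) (h1 : i + 1 < m), ∀ p q : T.V,
    T.E p (T.label (x ⟨i, Nat.lt_of_succ_lt h1⟩)) →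
    T.E q (T.label (x ⟨i + 1, h1⟩)) → p = q ∨ T.E p q

/-- A common `m`-chain of `𝒯`: a sequence of `m ≥ 2` distinct taxa that is a chain in
every tree of `𝒯`. -/
def IsCommonChain (𝒯 : Set (RTree X)) {m : ℕ} (x : Fin m → X) : Prop :=
  2 ≤ m ∧ Function.Injective x ∧ ∀ T ∈ 𝒯, T.IsChainIn x

/-- `T[S]` is pendant in `T`: there is an edge `(u,v)` such that the leaves below `v`
are exactly those labelled by `S`. -/
def IsPendant (T : RTree X) (S : Set X) : Prop :=
  ∃ u v : T.V, T.E u v ∧ ∀ x : X, (T.anc v (T.label x) ↔ x ∈ S)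

/-- A label-preserving isomorphism between `T[S]` and `T'[S]` respecting directions. -/
def pendantIso (T T' : RTree X) (S : Set X) : Prop :=
  ∃ φ : T.V → T'.V, Set.BijOn φ (T.spanSet S) (T'.spanSet S) ∧
    (∀ x ∈ S, φ (T.label x) = T'.label x) ∧
    ∀ u v : T.V, u ∈ T.spanSet S → v ∈ T.spanSet S →
      (T.E u v ↔ T'.E (φ u) (φ v))

/-- `S` induces a common pendant subtree of `𝒯`. -/
def InducesCommonPendant (𝒯 : Set (RTree X)) (S : Set X) : Prop :=
  S.Nonempty ∧ (∀ T ∈ 𝒯, IsPendant T S) ∧ ∀ T ∈ 𝒯, ∀ T' ∈ 𝒯, pendantIso T T' S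

/-- `T'` is (isomorphic to) the restriction `T|X'` of `T` to the taxa in `X'`. -/
def IsRestrictionOf (T : RTree X) (X' : Set X) (T' : RTree X') : Prop :=
  ∃ φ : T'.V → T.V, Function.Injective φ ∧
    (∀ x : X', φ (T'.label x) = T.label x.val) ∧
    Set.range φ = T.keepSet X' ∧
    ∀ u v : T'.V, T'.E u v ↔ T.restAdj X' (φ u) (φ v)

/-- `𝒯' = { T|X' : T ∈ 𝒯 }` up to label-preserving isomorphism. -/
def IsRestrictionFamily (𝒯 : Set (RTree X)) (X' : Set X) (𝒯' : Set (RTree X')) : Prop :=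
  (∀ T' ∈ 𝒯', ∃ T ∈ 𝒯, IsRestrictionOf T X' T') ∧
  ∀ T ∈ 𝒯, ∃ T' ∈ 𝒯', IsRestrictionOf T X' T'

/-- The subtree reduction rule is applicable: some `S` with `|S| ≥ 2` induces a common
pendant subtree. -/
def SubtreeRuleApplicable (𝒯 : Set (RTree X)) : Prop :=
  ∃ S : Set X, 2 ≤ S.ncard ∧ InducesCommonPendant 𝒯 S

/-- The chain reduction rule (with truncation length `r`) is applicable: `𝒯` has a
common `m`-chain with `m > r`. -/
def ChainRuleApplicable (𝒯 : Set (RTree X)) (r : ℕ) : Prop :=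
  ∃ (m : ℕ) (x : Fin m → X), r < m ∧ IsCommonChain 𝒯 x

end RTree

namespace RTree

section general

variable {X : Type} (T : RTree X)

theorem anc_of_path {R : T.V → T.V → Prop} (hR : ∀ a b, R a b → T.E a b) {u v : T.V}
    (h : Relation.ReflTransGen R u v) : T.anc u v := by
  induction h with
  | refl => exact Relation.ReflTransGen.refl
  | tail _ h2 ih => exact ih.tail (hR _ _ h2)

theorem E_unique {p q v : T.V} (h1 : T.E p v) (h2 : T.E q v) : p = q := by
  have hv : v ≠ T.root := by
    rintro rfl
    exact T.not_into_root _ h1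
  obtain ⟨a, ha⟩ := Set.ncard_eq_one.1 (T.in_one v hv)
  have e1 : p ∈ ({a} : Set T.V) := ha ▸ h1
  have e2 : q ∈ ({a} : Set T.V) := ha ▸ h2
  rw [Set.mem_singleton_iff] at e1 e2
  rw [e1, e2]

theorem acyclic (v : T.V) : ¬ Relation.TransGen T.E v v := by
  induction T.reach_root v with
  | refl =>
    intro h
    obtain ⟨b, _, hb⟩ := Relation.TransGen.tail'_iff.1 h
    exact T.not_into_root _ hb
  | tail _ hE ih =>
    intro h
    obtain ⟨b, hb1, hb2⟩ := Relation.TransGen.tail'_iff.1 h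
    have := T.E_unique hE hb2
    subst this
    exact ih (Relation.TransGen.head' hE hb1)

theorem anc_antisymm {u v : T.V} (h1 : T.anc u v) (h2 : T.anc v u) : u = v := by
  rcases Relation.reflTransGen_iff_eq_or_transGen.1 h1 with h | h
  · exact h.symm
  · exact absurd (h.trans_left h2) (T.acyclic u)

theorem not_E_anc {u v : T.V} (h1 : T.E u v) (h2 : T.anc v u) : False :=
  T.acyclic u (Relation.TransGen.head' h1 h2)

theorem anc_pred {u v w : T.V} (h1 : T.E u v) (h2 : T.anc w v) : w = v ∨ T.anc w u := by
  rcases Relation.ReflTransGen.cases_tail h2 with h | ⟨p, hp, hpv⟩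
  · exact Or.inl h.symm
  · right
    have := T.E_unique h1 hpv
    subst this
    exact hp

theorem anc_comparable {u w v : T.V} (h1 : T.anc u v) (h2 : T.anc w v) :
    T.anc u w ∨ T.anc w u := by
  induction h1 with
  | refl => exact Or.inr h2
  | tail hb hE ih =>
    rcases T.anc_pred hE h2 with h | h
    · subst h
      exact Or.inl (hb.tail hE)
    · exact ih h

theorem E_iff_cover (u v : T.V) :
    T.E u v ↔ T.anc u v ∧ u ≠ v ∧ ∀ w, T.anc u w → T.anc w v → w = u ∨ w = v := by
  constructor
  · intro h
    refine ⟨Relation.ReflTransGen.single h, ?_, ?_⟩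
    · rintro rfl
      exact T.not_E_anc h Relation.ReflTransGen.refl
    · intro w h1 h2
      rcases T.anc_pred h h2 with h3 | h3
      · exact Or.inr h3
      · exact Or.inl (T.anc_antisymm h3 h1)
  · rintro ⟨h1, h2, h3⟩
    rcases Relation.ReflTransGen.cases_head h1 with h | ⟨w, hw, hwv⟩
    · exact absurd h h2
    · rcases h3 w (Relation.ReflTransGen.single hw) hwv with h | h
      · subst h
        exact (T.not_E_anc hw Relation.ReflTransGen.refl).elim
      · subst h
        exact hw

theorem span_between {B : Set X} {u v w : T.V} (hu : u ∈ T.spanSet B) (hv : v ∈ T.spanSet B)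
    (h1 : T.anc u w) (h2 : T.anc w v) : w ∈ T.spanSet B := by
  obtain ⟨⟨x, hx, hxv⟩, _⟩ := hv
  exact ⟨⟨x, hx, h2.trans hxv⟩, fun c hc => (hu.2 c hc).trans h1⟩

theorem anc_of_restAdj {B : Set X} {u v : T.V} (h : T.restAdj B u v) : T.anc u v :=
  T.anc_of_path (fun _ _ h => h.1) h.2.2.2

theorem restAdj_iff_cover {B : Set X} (u v : T.V) (hu : u ∈ T.keepSet B)
    (hv : v ∈ T.keepSet B) :
    T.restAdj B u v ↔ T.anc u v ∧ u ≠ v ∧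
      ∀ w ∈ T.keepSet B, T.anc u w → T.anc w v → w = u ∨ w = v := by
  constructor
  · intro h
    refine ⟨T.anc_of_restAdj h, h.2.2.1, ?_⟩
    intro w hw
    have hp := h.2.2.2
    clear h hu
    induction hp using Relation.ReflTransGen.head_induction_on with
    | refl =>
      intro h1 h2
      exact Or.inr (T.anc_antisymm h2 h1)
    | head hE hR ih =>
      intro h1 h2
      rename_i a c
      have hcv : T.anc c v := T.anc_of_path (fun _ _ h => h.1) hR
      rcases T.anc_comparable hcv h2 with h3 | h3
      · rcases ih h3 h2 with h4 | h4
        · subst h4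
          rcases hE.2.2 with h5 | h5
          · exact Or.inr h5
          · exact absurd hw h5
        · exact Or.inr h4
      · rcases T.anc_pred hE.1 h3 with h4 | h4
        · subst h4
          rcases hE.2.2 with h5 | h5
          · exact Or.inr h5
          · exact absurd hw h5
        · exact Or.inl (T.anc_antisymm h4 h1)
  · rintro ⟨h1, h2, h3⟩
    refine ⟨hu, hv, h2, ?_⟩
    have key : ∀ w, T.anc w v → T.anc u w → Relation.ReflTransGen
      (fun a b => T.E a b ∧ b ∈ T.spanSet B ∧ (b = v ∨ b ∉ T.keepSet B)) w v := by
      intro w hw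
      induction hw using Relation.ReflTransGen.head_induction_on with
      | refl => intro _; exact Relation.ReflTransGen.refl
      | head hE hR ih =>
        rename_i a c
        intro hua
        have huc : T.anc u c := hua.tail hE
        refine Relation.ReflTransGen.head ⟨hE, T.span_between hu.1 hv.1 huc hR, ?_⟩ (ih huc)
        by_cases hc : c ∈ T.keepSet B
        · rcases h3 c hc huc hR with h | h
          · subst h
            exact (T.not_E_anc hE hua).elim
          · exact Or.inl h
        · exact Or.inr hc
    exact key u h1 Relation.ReflTransGen.refl

theorem anc_iff_restAdj {B : Set X} (u v : T.V) (hu : u ∈ T.keepSet B)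
    (hv : v ∈ T.keepSet B) :
    T.anc u v ↔ Relation.ReflTransGen (T.restAdj B) u v := by
  constructor
  · intro h
    have key : ∀ w, T.anc w v → T.anc u w → ∃ k ∈ T.keepSet B,
        Relation.ReflTransGen (T.restAdj B) k v ∧ (w = k ∨ w ∉ T.keepSet B) ∧
        Relation.ReflTransGen
          (fun a b => T.E a b ∧ b ∈ T.spanSet B ∧ (b = k ∨ b ∉ T.keepSet B)) w k := by
      intro w hw
      induction hw using Relation.ReflTransGen.head_induction_on with
      | refl =>
        intro _
        exact ⟨v, hv, Relation.ReflTransGen.refl, Or.inl rfl, Relation.ReflTransGen.refl⟩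
      | head hE hR ih =>
        rename_i a c
        intro hua
        have huc : T.anc u c := hua.tail hE
        obtain ⟨k, hk, hkv, hck, hp⟩ := ih huc
        have hp' := Relation.ReflTransGen.head (r := fun a b => T.E a b ∧ b ∈ T.spanSet B ∧
          (b = k ∨ b ∉ T.keepSet B)) ⟨hE, T.span_between hu.1 hv.1 huc hR, hck⟩ hp
        by_cases ha : a ∈ T.keepSet B
        · refine ⟨a, ha, Relation.ReflTransGen.head ⟨ha, hk, ?_, hp'⟩ hkv, Or.inl rfl,
            Relation.ReflTransGen.refl⟩
          rintro rfl
          exact T.not_E_anc hE (T.anc_of_path (fun _ _ h => h.1) hp)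
        · exact ⟨k, hk, hkv, Or.inr ha, hp'⟩
    obtain ⟨k, hk, hkv, hck, _⟩ := key u h Relation.ReflTransGen.refl
    rcases hck with h | h
    · rw [h]; exact hkv
    · exact absurd hu h
  · intro h
    induction h with
    | refl => exact Relation.ReflTransGen.refl
    | tail _ h2 ih => exact (ih h2.1).trans (T.anc_of_restAdj h2)

theorem label_span {B : Set X} {x : X} (hx : x ∈ B) : T.label x ∈ T.spanSet B :=
  ⟨⟨x, hx, Relation.ReflTransGen.refl⟩, fun _ hw => hw x hx⟩

theorem label_keep {B : Set X} {x : X} (hx : x ∈ B) : T.label x ∈ T.keepSet B :=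
  ⟨T.label_span hx, Or.inl ⟨x, hx, rfl⟩⟩

theorem span_singleton (x : X) : T.spanSet {x} = {T.label x} := by
  ext v
  constructor
  · rintro ⟨⟨y, hy, h1⟩, h2⟩
    rw [Set.mem_singleton_iff] at hy
    subst hy
    refine T.anc_antisymm h1 (h2 _ ?_)
    intro x hx
    rw [Set.mem_singleton_iff] at hx
    subst hx
    exact Relation.ReflTransGen.refl
  · intro h
    rw [Set.mem_singleton_iff] at h
    subst h
    exact T.label_span rfl

theorem keep_singleton (x : X) : T.keepSet {x} = {T.label x} := by
  ext v
  constructor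
  · intro h
    rw [← T.span_singleton]
    exact h.1
  · intro h
    rw [Set.mem_singleton_iff] at h
    subst h
    exact T.label_keep rfl

/-- Ancestor relations are preserved by agreement of restrictions. -/
theorem restEq_anc {T T' : RTree X} {B : Set X} {φ : T.V → T'.V}
    (hb : Set.BijOn φ (T.keepSet B) (T'.keepSet B))
    (hadj : ∀ u v : T.V, u ∈ T.keepSet B → v ∈ T.keepSet B →
      (T.restAdj B u v ↔ T'.restAdj B (φ u) (φ v))) (u v : T.V)
    (hu : u ∈ T.keepSet B) (hv : v ∈ T.keepSet B) :
    T.anc u v ↔ T'.anc (φ u) (φ v) := by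
  rw [T.anc_iff_restAdj u v hu hv, T'.anc_iff_restAdj _ _ (hb.mapsTo hu) (hb.mapsTo hv)]
  constructor
  · intro h
    clear hv
    induction h with
    | refl => exact Relation.ReflTransGen.refl
    | tail _ h2 ih => exact ih.tail ((hadj _ _ h2.1 h2.2.1).1 h2)
  · intro h
    have key : ∀ y, Relation.ReflTransGen (T'.restAdj B) (φ u) y →
        ∃ v ∈ T.keepSet B, φ v = y ∧ Relation.ReflTransGen (T.restAdj B) u v := by
      intro y h
      induction h with
      | refl => exact ⟨u, hu, rfl, Relation.ReflTransGen.refl⟩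
      | tail _ h2 ih =>
        obtain ⟨w, hw, rfl, hp⟩ := ih
        obtain ⟨w', hw', rfl⟩ := hb.surjOn h2.2.1
        exact ⟨w', hw', rfl, hp.tail ((hadj _ _ hw hw').2 h2)⟩
    obtain ⟨w, hw, hwv, hp⟩ := key _ h
    rw [← hb.injOn hw hv hwv]
    exact hp

theorem restEq_of_anc {T T' : RTree X} {B : Set X} {φ : T.V → T'.V}
    (hb : Set.BijOn φ (T.keepSet B) (T'.keepSet B))
    (hl : ∀ x ∈ B, φ (T.label x) = T'.label x)
    (ha : ∀ u v : T.V, u ∈ T.keepSet B → v ∈ T.keepSet B →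
      (T.anc u v ↔ T'.anc (φ u) (φ v))) : restEq T T' B := by
  refine ⟨φ, hb, hl, fun u v hu hv => ?_⟩
  rw [T.restAdj_iff_cover u v hu hv,
    T'.restAdj_iff_cover _ _ (hb.mapsTo hu) (hb.mapsTo hv), ← ha u v hu hv, hb.injOn.ne_iff hu hv]
  refine and_congr_right fun _ => and_congr_right fun _ => ?_
  constructor
  · intro h w hw h1 h2
    obtain ⟨w, hw', rfl⟩ := hb.surjOn hw
    rcases h w hw' ((ha _ _ hu hw').2 h1) ((ha _ _ hw' hv).2 h2) with h | h
    · exact Or.inl (by rw [h])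
    · exact Or.inr (by rw [h])
  · intro h w hw h1 h2
    rcases h (φ w) (hb.mapsTo hw) ((ha _ _ hu hw).1 h1) ((ha _ _ hw hv).1 h2) with h | h
    · exact Or.inl (hb.injOn hw hu h)
    · exact Or.inr (hb.injOn hw hv h)

end general

section cat

variable {X : Type}

/-- Edges of the caterpillar: `inl a` is the spine vertex above leaf `a`, ordered by `r`,
the last spine vertex `inl z` being itself the leaf `z`. -/
def catE (r : X → ℕ) (z : X) : X ⊕ {x : X // x ≠ z} → X ⊕ {x : X // x ≠ z} → Prop
  | Sum.inl a, Sum.inl b => r a < r b ∧ ∀ c, r c ≤ r a ∨ r b ≤ r c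
  | Sum.inl a, Sum.inr b => a = b.1
  | Sum.inr _, _ => False

def catRk (r : X → ℕ) (z : X) : X ⊕ {x : X // x ≠ z} → ℕ
  | Sum.inl a => r a
  | Sum.inr b => r b.1

open Classical in
noncomputable def catLabel (z : X) (x : X) : X ⊕ {x : X // x ≠ z} :=
  if h : x = z then Sum.inl z else Sum.inr ⟨x, h⟩

theorem catLabel_self (z : X) : catLabel z z = Sum.inl z := by simp [catLabel]

theorem catLabel_ne {z x : X} (h : x ≠ z) : catLabel z x = Sum.inr ⟨x, h⟩ := by
  simp [catLabel, h]

theorem cat_pred [Finite X] (r : X → ℕ) (b : X) (h : ∃ c, r c < r b) :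
    ∃ p, r p < r b ∧ ∀ c, r c ≤ r p ∨ r b ≤ r c := by
  obtain ⟨p, hp, hmax⟩ := Set.exists_max_image {c | r c < r b} r (Set.toFinite _) h
  refine ⟨p, hp, fun c => ?_⟩
  by_cases hc : r c < r b
  · exact Or.inl (hmax c hc)
  · exact Or.inr (not_lt.1 hc)

theorem cat_succ [Finite X] (r : X → ℕ) (a : X) (h : ∃ c, r a < r c) :
    ∃ p, r a < r p ∧ ∀ c, r c ≤ r a ∨ r p ≤ r c := by
  obtain ⟨p, hp, hmin⟩ := Set.exists_min_image {c | r a < r c} r (Set.toFinite _) h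
  refine ⟨p, hp, fun c => ?_⟩
  by_cases hc : r a < r c
  · exact Or.inr (hmin c hc)
  · exact Or.inl (not_lt.1 hc)

theorem cat_reach [Finite X] (r : X → ℕ) (hr : Function.Injective r) (z : X) (a : X) :
    ∀ (n : ℕ) (b : X), r b = n → r a ≤ r b →
      Relation.ReflTransGen (catE r z) (Sum.inl a) (Sum.inl b) := by
  intro n
  induction n using Nat.strong_induction_on with
  | _ n ih =>
    intro b hb hab
    rcases hab.eq_or_lt with h | h
    · rw [hr h]
    · obtain ⟨p, hp, hp2⟩ := cat_pred r b ⟨a, h⟩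
      have hap : r a ≤ r p := by
        rcases hp2 a with h | h
        · exact h
        · omega
      exact (ih (r p) (by omega) p rfl hap).tail ⟨hp, hp2⟩

theorem catE_rk {r : X → ℕ} {z : X} {u v : X ⊕ {x : X // x ≠ z}} (h : catE r z u v) :
    catRk r z u ≤ catRk r z v := by
  rcases u with a | a <;> rcases v with b | b
  · exact h.1.le
  · exact (congrArg r h).le
  · exact h.elim
  · exact h.elim

theorem cat_reach_rk {r : X → ℕ} {z : X} {u v : X ⊕ {x : X // x ≠ z}}
    (h : Relation.ReflTransGen (catE r z) u v) : catRk r z u ≤ catRk r z v := by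
  induction h with
  | refl => exact le_rfl
  | tail _ h ih => exact ih.trans (catE_rk h)

theorem exists_catRoot [Finite X] (r : X → ℕ) (z : X) : ∃ a, ∀ b, r a ≤ r b := by
  haveI : Nonempty X := ⟨z⟩
  exact Finite.exists_min r

/-- The caterpillar whose leaves appear from the root in the order of `r`. -/
noncomputable def cat [Finite X] (r : X → ℕ) (hr : Function.Injective r) (z : X)
    (hz : ∀ x, r x ≤ r z) : RTree X where
  V := X ⊕ {x : X // x ≠ z}
  finV := inferInstance
  E := catE r z
  root := Sum.inl (exists_catRoot r z).choose
  label := catLabel z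
  label_inj := by
    intro x y h
    by_cases hx : x = z <;> by_cases hy : y = z
    · rw [hx, hy]
    · rw [hx, catLabel_self, catLabel_ne hy] at h
      exact absurd h (by simp)
    · rw [hy, catLabel_self, catLabel_ne hx] at h
      exact absurd h (by simp)
    · rw [catLabel_ne hx, catLabel_ne hy] at h
      simpa using h
  reach_root := by
    have h := (exists_catRoot r z).choose_spec
    rintro (b | b)
    · exact cat_reach r hr z _ _ b rfl (h b)
    · exact (cat_reach r hr z _ _ b.1 rfl (h b.1)).tail rfl
  not_into_root := by
    have h := (exists_catRoot r z).choose_spec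
    rintro (u | u) hE
    · exact absurd hE.1 (not_lt.2 (h u))
    · exact hE
  leaf_iff := by
    rintro (a | a)
    · constructor
      · intro h
        by_cases ha : a = z
        · exact ⟨z, by rw [catLabel_self, ha]⟩
        · exfalso
          have : (Sum.inr ⟨a, ha⟩ : X ⊕ {x : X // x ≠ z}) ∈ {w | catE r z (Sum.inl a) w} := rfl
          rw [h] at this
          exact this
      · rintro ⟨x, hx⟩
        have hxz : x = z := by
          by_contra hne
          rw [catLabel_ne hne] at hx
          simp at hx
        subst hxz
        rw [catLabel_self] at hx
        obtain rfl := Sum.inl_injective hx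
        ext w
        simp only [Set.mem_setOf_eq, Set.mem_empty_iff_false, iff_false]
        rcases w with b | b
        · intro h
          exact absurd h.1 (not_lt.2 (hz b))
        · intro h
          exact b.2 h.symm
    · constructor
      · intro _
        exact ⟨a.1, catLabel_ne a.2⟩
      · intro _
        ext w
        simp [catE]
  out_two := by
    rintro (a | a) hnot
    · have ha : a ≠ z := by
        rintro rfl
        exact hnot ⟨a, catLabel_self a⟩
      have hlt : r a < r z := lt_of_le_of_ne (hz a) (fun h => ha (hr h))
      obtain ⟨p, hp, hp2⟩ := cat_succ r a ⟨z, hlt⟩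
      rw [Set.ncard_eq_two]
      refine ⟨Sum.inl p, Sum.inr ⟨a, ha⟩, by simp, ?_⟩
      ext w
      rcases w with b | b
      · simp only [Set.mem_setOf_eq, Set.mem_insert_iff, Set.mem_singleton_iff, Sum.inl.injEq,
          reduceCtorEq, or_false]
        constructor
        · rintro ⟨h1, h2⟩
          apply hr
          rcases hp2 b with h | h <;> rcases h2 p with h' | h' <;> omega
        · rintro rfl
          exact ⟨hp, hp2⟩
      · simp only [Set.mem_setOf_eq, Set.mem_insert_iff, Set.mem_singleton_iff, Sum.inr.injEq,
          reduceCtorEq, false_or, catE]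
        constructor
        · intro h
          exact Subtype.ext h.symm
        · rintro rfl
          rfl
    · exact absurd ⟨a.1, catLabel_ne a.2⟩ hnot
  in_one := by
    have hroot := (exists_catRoot r z).choose_spec
    rintro (b | b) hne
    · have hlt : ∃ c, r c < r b := by
        refine ⟨(exists_catRoot r z).choose, lt_of_le_of_ne (hroot b) fun h => hne ?_⟩
        rw [hr h]
      obtain ⟨p, hp, hp2⟩ := cat_pred r b hlt
      rw [Set.ncard_eq_one]
      refine ⟨Sum.inl p, ?_⟩
      ext w
      rcases w with c | c
      · simp only [Set.mem_setOf_eq, Set.mem_singleton_iff, Sum.inl.injEq]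
        constructor
        · rintro ⟨h1, h2⟩
          apply hr
          rcases hp2 c with h | h <;> rcases h2 p with h' | h' <;> omega
        · rintro rfl
          exact ⟨hp, hp2⟩
      · simp [catE]
    · rw [Set.ncard_eq_one]
      refine ⟨Sum.inl b.1, ?_⟩
      ext w
      rcases w with c | c
      · simp [catE]
      · simp [catE]

variable [Finite X] (r : X → ℕ) (hr : Function.Injective r) (z : X) (hz : ∀ x, r x ≤ r z)

theorem cat_anc_inl (a b : X) :
    (cat r hr z hz).anc (Sum.inl a) (Sum.inl b) ↔ r a ≤ r b :=
  ⟨fun h => cat_reach_rk h, fun h => cat_reach r hr z a _ b rfl h⟩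

theorem cat_anc_inl_inr (a : X) (b : {x : X // x ≠ z}) :
    (cat r hr z hz).anc (Sum.inl a) (Sum.inr b) ↔ r a ≤ r b.1 :=
  ⟨fun h => cat_reach_rk h, fun h => (cat_reach r hr z a _ b.1 rfl h).tail rfl⟩

theorem cat_anc_inr (a : {x : X // x ≠ z}) (v : X ⊕ {x : X // x ≠ z}) :
    (cat r hr z hz).anc (Sum.inr a) v ↔ v = Sum.inr a := by
  constructor
  · intro h
    rcases Relation.ReflTransGen.cases_head h with h | ⟨w, hw, _⟩
    · exact h.symm
    · exact hw.elim
  · rintro rfl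
    exact Relation.ReflTransGen.refl

theorem cat_anc_label (a x : X) :
    (cat r hr z hz).anc (Sum.inl a) (catLabel z x) ↔ r a ≤ r x := by
  by_cases h : x = z
  · subst h
    rw [catLabel_self]
    exact cat_anc_inl r hr x hz a x
  · rw [catLabel_ne h]
    exact cat_anc_inl_inr r hr z hz a ⟨x, h⟩

theorem cat_anc_inr_label (a : {x : X // x ≠ z}) (x : X) :
    (cat r hr z hz).anc (Sum.inr a) (catLabel z x) ↔ x = a.1 := by
  refine (cat_anc_inr r hr z hz a _).trans ?_
  rw [← catLabel_ne a.2]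
  exact (cat r hr z hz).label_inj.eq_iff

/-- A common ancestor of two leaves is a spine vertex. -/
theorem cat_common_anc {w : (cat r hr z hz).V} {p q : X} (hpq : p ≠ q)
    (h1 : (cat r hr z hz).anc w (catLabel z p)) (h2 : (cat r hr z hz).anc w (catLabel z q)) :
    ∃ c, w = Sum.inl c ∧ r c ≤ r p ∧ r c ≤ r q := by
  rcases w with c | c
  · exact ⟨c, rfl, (cat_anc_label r hr z hz c p).1 h1, (cat_anc_label r hr z hz c q).1 h2⟩
  · exact absurd (((cat_anc_inr_label r hr z hz c p).1 h1).trans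
      ((cat_anc_inr_label r hr z hz c q).1 h2).symm) hpq

theorem cat_span_mem {B : Set X} {p q c : X} (hp : p ∈ B) (hq : q ∈ B) (hpq : p ≠ q)
    (h1 : r p ≤ r c) (h2 : r c ≤ r q) :
    (Sum.inl c : X ⊕ {x : X // x ≠ z}) ∈ (cat r hr z hz).spanSet B := by
  refine ⟨⟨q, hq, (cat_anc_label r hr z hz c q).2 h2⟩, fun w hw => ?_⟩
  obtain ⟨d, rfl, hd, _⟩ := cat_common_anc r hr z hz hpq (hw p hp) (hw q hq)
  exact (cat_anc_inl r hr z hz d c).2 (hd.trans h1)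

theorem cat_span_inr {B : Set X} {c : {x : X // x ≠ z}}
    (h : (Sum.inr c : X ⊕ {x : X // x ≠ z}) ∈ (cat r hr z hz).spanSet B) : c.1 ∈ B := by
  obtain ⟨⟨x, hx, h1⟩, _⟩ := h
  have := (cat_anc_inr_label r hr z hz c x).1 h1
  exact this ▸ hx

/-- Spine vertices with a taxon of the block, and another one below it, survive. -/
theorem cat_keep_inl {B : Set X} {p q : X} (hp : p ∈ B) (hq : q ∈ B) (h : r p < r q) :
    (Sum.inl p : X ⊕ {x : X // x ≠ z}) ∈ (cat r hr z hz).keepSet B := by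
  have hpq : p ≠ q := by
    rintro rfl
    exact lt_irrefl _ h
  have hpz : p ≠ z := by
    rintro rfl
    exact absurd h (not_lt.2 (hz q))
  obtain ⟨s, hs, hs2⟩ := cat_succ r p ⟨q, h⟩
  have hsq : r s ≤ r q := by
    rcases hs2 q with h' | h'
    · omega
    · exact h'
  refine ⟨cat_span_mem r hr z hz hp hq hpq le_rfl h.le, Or.inr ?_⟩
  haveI := (cat r hr z hz).finV
  have hsub : ({Sum.inl s, Sum.inr ⟨p, hpz⟩} : Set (X ⊕ {x : X // x ≠ z})) ⊆
      ({w | (cat r hr z hz).E (Sum.inl p) w} ∩ (cat r hr z hz).spanSet B :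
        Set (cat r hr z hz).V) := by
    intro w hw
    rcases hw with hw | hw
    · subst hw
      exact ⟨⟨hs, hs2⟩, cat_span_mem r hr z hz hp hq hpq hs.le hsq⟩
    · rw [Set.mem_singleton_iff] at hw
      subst hw
      refine ⟨rfl, ?_⟩
      rw [← catLabel_ne hpz]
      exact (cat r hr z hz).label_span hp
  have h2 : ({Sum.inl s, Sum.inr ⟨p, hpz⟩} : Set (X ⊕ {x : X // x ≠ z})).ncard = 2 :=
    Set.ncard_pair (by simp)
  rw [← h2]
  exact Set.ncard_le_ncard hsub (Set.toFinite _)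

/-- The taxon above a vertex. -/
def under (z : X) : X ⊕ {x : X // x ≠ z} → X
  | Sum.inl a => a
  | Sum.inr b => b.1

theorem cat_keep_iff {B : Set X} (hzB : z ∈ B) (v : X ⊕ {x : X // x ≠ z}) :
    v ∈ (cat r hr z hz).keepSet B ↔ under z v ∈ B := by
  rcases v with c | c
  · constructor
    · rintro ⟨_, h | h⟩
      · obtain ⟨x, hx, hxc⟩ := h
        have hxc : catLabel z x = Sum.inl c := hxc
        have hxz : x = z := by
          by_contra hne
          rw [catLabel_ne hne] at hxc
          simp at hxc
        subst hxz
        rw [catLabel_self] at hxc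
        obtain rfl := Sum.inl_injective hxc
        exact hx
      · by_contra hc
        haveI := (cat r hr z hz).finV
        obtain ⟨u, v, hu, hv, huv⟩ := (Set.one_lt_ncard_iff (Set.toFinite _)).1 h
        have hsp : ∀ w : (cat r hr z hz).V, w ∈ {w | (cat r hr z hz).E (Sum.inl c) w} ∩
            (cat r hr z hz).spanSet B →
            ∃ d, w = Sum.inl d ∧ r c < r d ∧ ∀ e, r e ≤ r c ∨ r d ≤ r e := by
          rintro (d | d) ⟨h1, h2⟩
          · exact ⟨d, rfl, h1⟩
          · have h3 := cat_span_inr r hr z hz h2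
            have h1 : c = d.1 := h1
            exact absurd (h1 ▸ h3) hc
        obtain ⟨d, rfl, h1, h2⟩ := hsp u hu
        obtain ⟨e, rfl, h3, h4⟩ := hsp v hv
        apply huv
        have : d = e := by
          apply hr
          rcases h2 e with h | h <;> rcases h4 d with h' | h' <;> omega
        rw [this]
    · intro h
      have h : c ∈ B := h
      by_cases hc : c = z
      · subst hc
        rw [← catLabel_self]
        exact (cat r hr c hz).label_keep hzB
      · exact cat_keep_inl r hr z hz h hzB (lt_of_le_of_ne (hz c) fun h => hc (hr h))
  · constructor
    · intro h
      exact cat_span_inr r hr z hz h.1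
    · intro h
      rw [← catLabel_ne c.2]
      exact (cat r hr z hz).label_keep h

theorem cat_restEq (r' : X → ℕ) (hr' : Function.Injective r') (hz' : ∀ x, r' x ≤ r' z)
    {B : Set X} (hzB : z ∈ B) (h : ∀ a ∈ B, ∀ b ∈ B, r a ≤ r b ↔ r' a ≤ r' b) :
    restEq (cat r hr z hz) (cat r' hr' z hz') B := by
  refine restEq_of_anc (T := cat r hr z hz) (T' := cat r' hr' z hz')
    (φ := (id : X ⊕ {x : X // x ≠ z} → X ⊕ {x : X // x ≠ z})) ?_ (fun _ _ => rfl) ?_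
  · have : (cat r hr z hz).keepSet B = (cat r' hr' z hz').keepSet B := by
      ext v
      exact (cat_keep_iff r hr z hz hzB v).trans (cat_keep_iff r' hr' z hz' hzB v).symm
    rw [this]
    exact Set.bijOn_id _
  · intro u v hu hv
    have hu' := (cat_keep_iff r hr z hz hzB u).1 hu
    have hv' := (cat_keep_iff r hr z hz hzB v).1 hv
    rcases u with a | a
    · rcases v with b | b
      · exact (cat_anc_inl r hr z hz a b).trans
          ((h a hu' b hv').trans (cat_anc_inl r' hr' z hz' a b).symm)
      · exact (cat_anc_inl_inr r hr z hz a b).trans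
          ((h a hu' b.1 hv').trans (cat_anc_inl_inr r' hr' z hz' a b).symm)
    · exact (cat_anc_inr r hr z hz a v).trans (cat_anc_inr r' hr' z hz' a v).symm

theorem cat_restEq_singleton (r' : X → ℕ) (hr' : Function.Injective r')
    (hz' : ∀ x, r' x ≤ r' z) (x : X) :
    restEq (cat r hr z hz) (cat r' hr' z hz') {x} := by
  refine restEq_of_anc (T := cat r hr z hz) (T' := cat r' hr' z hz')
    (φ := (id : X ⊕ {x : X // x ≠ z} → X ⊕ {x : X // x ≠ z})) ?_ (fun _ _ => rfl) ?_
  · rw [keep_singleton, keep_singleton]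
    exact Set.bijOn_id _
  · intro u v hu hv
    rw [keep_singleton, Set.mem_singleton_iff] at hu hv
    subst hu
    subst hv
    exact ⟨fun _ => Relation.ReflTransGen.refl, fun _ => Relation.ReflTransGen.refl⟩

/-- Restricting a caterpillar to a set containing the bottom leaf. -/
theorem cat_restriction {B : Set X} (hzB : z ∈ B)
    (hr' : Function.Injective fun x : B => r x.1)
    (hz' : ∀ x : B, r x.1 ≤ r (⟨z, hzB⟩ : B).1) :
    IsRestrictionOf (cat r hr z hz) B (cat (fun x : B => r x.1) hr' ⟨z, hzB⟩ hz') := by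
  have hne : ∀ b : {x : B // x ≠ ⟨z, hzB⟩}, b.1.1 ≠ z := fun b h => b.2 (Subtype.ext h)
  let φ : B ⊕ {x : B // x ≠ ⟨z, hzB⟩} → X ⊕ {x : X // x ≠ z} :=
    Sum.map (fun a => a.1) (fun b => ⟨b.1.1, hne b⟩)
  have hinj : Function.Injective φ := by
    apply Function.Injective.sumMap
    · exact Subtype.val_injective
    · intro a b h
      apply Subtype.ext
      apply Subtype.ext
      exact congrArg (fun q : {x : X // x ≠ z} => q.1) h
  have hrange : Set.range φ = (cat r hr z hz).keepSet B := by
    ext v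
    refine Iff.trans ?_ (cat_keep_iff r hr z hz hzB v).symm
    constructor
    · rintro ⟨a | a, rfl⟩
      · exact a.2
      · exact a.1.2
    · rcases v with c | c
      · intro h
        exact ⟨Sum.inl ⟨c, h⟩, rfl⟩
      · intro h
        exact ⟨Sum.inr ⟨⟨c.1, h⟩, fun h' => c.2 (congrArg Subtype.val h')⟩, rfl⟩
  have hanc : ∀ u v, (cat (fun x : B => r x.1) hr' ⟨z, hzB⟩ hz').anc u v ↔
      (cat r hr z hz).anc (φ u) (φ v) := by
    rintro (a | a) v
    · rcases v with b | b
      · exact (cat_anc_inl _ hr' _ hz' a b).trans (cat_anc_inl r hr z hz a.1 b.1).symm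
      · exact (cat_anc_inl_inr _ hr' _ hz' a b).trans
          (cat_anc_inl_inr r hr z hz a.1 ⟨b.1.1, hne b⟩).symm
    · refine (cat_anc_inr _ hr' _ hz' a v).trans ?_
      refine Iff.trans ?_ (cat_anc_inr r hr z hz ⟨a.1.1, hne a⟩ (φ v)).symm
      exact (hinj.eq_iff (a := v) (b := Sum.inr a)).symm
  refine ⟨φ, hinj, ?_, hrange, ?_⟩
  · intro x
    change φ (catLabel _ x) = catLabel z x.1
    by_cases hx : x = ⟨z, hzB⟩
    · subst hx
      rw [catLabel_self, catLabel_self]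
      rfl
    · rw [catLabel_ne hx, catLabel_ne (fun h => hx (Subtype.ext h))]
      rfl
  · intro u v
    have hk : ∀ w, φ w ∈ (cat r hr z hz).keepSet B := fun w => hrange ▸ ⟨w, rfl⟩
    rw [E_iff_cover]
    refine Iff.trans ?_ ((cat r hr z hz).restAdj_iff_cover _ _ (hk u) (hk v)).symm
    refine and_congr (hanc u v) (and_congr hinj.ne_iff.symm ?_)
    constructor
    · intro h w hw h1 h2
      rw [← hrange] at hw
      obtain ⟨w, rfl⟩ := hw
      rcases h w ((hanc _ _).2 h1) ((hanc _ _).2 h2) with h | h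
      · exact Or.inl (by rw [h])
      · exact Or.inr (by rw [h])
    · intro h w h1 h2
      rcases h (φ w) (hk w) ((hanc _ _).1 h1) ((hanc _ _).1 h2) with h | h
      · exact Or.inl (hinj h)
      · exact Or.inr (hinj h)

/-- An order conflict on a triple excludes it from every block. -/
theorem cat_conflict (r' : X → ℕ) (hr' : Function.Injective r') (hz' : ∀ x, r' x ≤ r' z)
    {B : Set X} (h : restEq (cat r hr z hz) (cat r' hr' z hz') B) {a b y : X}
    (ha : a ∈ B) (hb : b ∈ B) (hy : y ∈ B) (hab : r a < r b) (hby : r b < r y)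
    (hya : r' y < r' a) : False := by
  obtain ⟨φ, hbij, hl, hadj⟩ := h
  have hanc := restEq_anc hbij hadj
  have hv := cat_keep_inl r hr z hz hb hy hby
  have e1 := (hanc _ _ hv ((cat r hr z hz).label_keep hb)).1
    ((cat_anc_label r hr z hz b b).2 le_rfl)
  have e2 := (hanc _ _ hv ((cat r hr z hz).label_keep hy)).1
    ((cat_anc_label r hr z hz b y).2 hby.le)
  rw [hl b hb] at e1
  rw [hl y hy] at e2
  have hne : b ≠ y := by
    rintro rfl
    exact lt_irrefl _ hby
  obtain ⟨c, hc, _, hcy⟩ := cat_common_anc r' hr' z hz' hne e1 e2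
  have e3 : (cat r' hr' z hz').anc (φ (Sum.inl b)) (φ ((cat r hr z hz).label a)) := by
    rw [hl a ha, hc]
    exact (cat_anc_label r' hr' z hz' c a).2 (hcy.trans hya.le)
  have e4 := (hanc _ _ hv ((cat r hr z hz).label_keep ha)).2 e3
  exact absurd ((cat_anc_label r hr z hz b a).1 e4) (not_le.2 hab)

/-- The order of the leaves can be read off the caterpillar. -/
theorem cat_order {a b : X} (ha : a ≠ z) :
    (∀ p, (cat r hr z hz).E p ((cat r hr z hz).label a) →
      (cat r hr z hz).anc p ((cat r hr z hz).label b)) ↔ r a ≤ r b := by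
  constructor
  · intro h
    refine (cat_anc_label r hr z hz a b).1 (h (Sum.inl a) ?_)
    change catE r z _ (catLabel z a)
    rw [catLabel_ne ha]
    rfl
  · rintro h (p | p) hp
    · change catE r z _ (catLabel z a) at hp
      rw [catLabel_ne ha] at hp
      have hp : p = a := hp
      subst hp
      exact (cat_anc_label r hr z hz p b).2 h
    · exact hp.elim

end cat

section construction

inductive Tax (m n : ℕ) : Type
  | z : Tax m n
  | x : Fin m → Tax m n
  | y : Fin n → Tax m n

variable {m n : ℕ}

instance : Finite (Tax m n) := by
  refine Finite.of_surjective
    (fun s : Option (Fin m ⊕ Fin n) => match s with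
      | none => Tax.z
      | some (Sum.inl a) => Tax.x a
      | some (Sum.inr b) => Tax.y b) ?_
  rintro (_ | a | b)
  · exact ⟨none, rfl⟩
  · exact ⟨some (Sum.inl a), rfl⟩
  · exact ⟨some (Sum.inr b), rfl⟩

/-- In tree `i` the first `i` of the `y` taxa are above the chain, the others below. -/
def rk (i : ℕ) : Tax m n → ℕ
  | Tax.z => m + 2 * n + 5
  | Tax.x a => n + a
  | Tax.y k => if (k : ℕ) < i then k else m + n + k

theorem rk_inj (i : ℕ) : Function.Injective (rk i : Tax m n → ℕ) := by
  rintro (_ | a | a) (_ | b | b) h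
  · rfl
  · simp only [rk] at h; omega
  · simp only [rk] at h; split_ifs at h <;> omega
  · simp only [rk] at h; omega
  · simp only [rk] at h
    exact congrArg Tax.x (Fin.ext (by omega))
  · simp only [rk] at h; split_ifs at h <;> omega
  · simp only [rk] at h; split_ifs at h <;> omega
  · simp only [rk] at h; split_ifs at h <;> omega
  · simp only [rk] at h
    refine congrArg Tax.y (Fin.ext ?_)
    split_ifs at h <;> omega

theorem rk_z (i : ℕ) (a : Tax m n) : rk i a ≤ rk i (Tax.z : Tax m n) := by
  rcases a with _ | a | a
  · exact le_rfl
  · simp only [rk]; omega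
  · simp only [rk]; split_ifs <;> omega

noncomputable def tr (m n i : ℕ) : RTree (Tax m n) := cat (rk i) (rk_inj i) Tax.z (rk_z i)

theorem tr_ne {i j : ℕ} (hij : i < j) (hj : j ≤ n) (hm : 0 < m) : tr m n i ≠ tr m n j := by
  intro h
  have h1 := cat_order (rk i) (rk_inj i) Tax.z (rk_z i) (a := (Tax.x ⟨0, hm⟩ : Tax m n))
    (b := Tax.y ⟨i, by omega⟩) (by simp)
  have h2 := cat_order (rk j) (rk_inj j) Tax.z (rk_z j) (a := (Tax.x ⟨0, hm⟩ : Tax m n))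
    (b := Tax.y ⟨i, by omega⟩) (by simp)
  change (∀ p, (tr m n i).E p ((tr m n i).label _) →
    (tr m n i).anc p ((tr m n i).label _)) ↔ _ at h1
  change (∀ p, (tr m n j).E p ((tr m n j).label _) →
    (tr m n j).anc p ((tr m n j).label _)) ↔ _ at h2
  rw [h] at h1
  have h3 := h1.symm.trans h2
  simp only [rk] at h3
  rw [if_neg (by omega), if_pos hij] at h3
  omega

theorem tr_chain (i : ℕ) : (tr m n i).IsChainIn (Tax.x : Fin m → Tax m n) := by
  intro a ha p q hp hq
  right
  have key : ∀ (b : Fin m) (p : (tr m n i).V), (tr m n i).E p ((tr m n i).label (Tax.x b)) →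
      p = Sum.inl (Tax.x b) := by
    intro b p hp
    change catE (rk i) Tax.z p (catLabel Tax.z (Tax.x b)) at hp
    rw [catLabel_ne (by simp)] at hp
    rcases p with p | p
    · have hp : p = Tax.x b := hp
      rw [hp]
    · exact hp.elim
  rw [key _ p hp, key _ q hq]
  refine ⟨?_, fun c => ?_⟩
  · simp only [rk]; omega
  · simp only [rk]; omega

/-- Lower bound on the size of an agreement forest. -/
theorem lower (hm : n + 1 < m) (F : Set (Set (Tax m n)))
    (hF : IsAgreementForest {T | ∃ i : Fin (n + 1), tr m n i = T} F) : n + 1 ≤ F.ncard := by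
  by_contra hlt
  push Not at hlt
  obtain ⟨⟨hne, hpart⟩, hag, hdis⟩ := hF
  choose blk hblk huniq using hpart
  haveI : Finite F := inferInstance
  have huni : ∀ x B, B ∈ F → x ∈ B → B = blk x := fun x B h1 h2 => huniq x B ⟨h1, h2⟩
  -- two chain taxa in a common block
  obtain ⟨a, b, hab, hB⟩ : ∃ a b : Fin m, a < b ∧ blk (Tax.x a) = blk (Tax.x b) := by
    by_contra hcon
    push Not at hcon
    have hinj : Function.Injective
        (fun a : Fin m => (⟨blk (Tax.x a), (hblk _).1⟩ : F)) := by
      intro a b h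
      have h : blk (Tax.x a) = blk (Tax.x b) := congrArg Subtype.val h
      rcases lt_trichotomy a b with h' | h' | h'
      · exact absurd h (hcon a b h')
      · exact h'
      · exact absurd h.symm (hcon b a h')
    have := Nat.card_le_card_of_injective _ hinj
    rw [Nat.card_coe_set_eq, Nat.card_fin] at this
    omega
  have hab' : (a : ℕ) < b := hab
  have haB : Tax.x a ∈ blk (Tax.x a) := (hblk _).2
  have hbB : Tax.x b ∈ blk (Tax.x a) := hB ▸ (hblk (Tax.x b)).2
  have hBF : blk (Tax.x a) ∈ F := (hblk _).1
  have hyB : ∀ k : Fin n, Tax.y k ∉ blk (Tax.x a) := by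
    intro k hk
    have h := hag _ hBF (tr m n k) ⟨⟨k, by omega⟩, rfl⟩ (tr m n (k + 1))
      ⟨⟨k + 1, by omega⟩, rfl⟩
    refine cat_conflict _ _ _ _ _ _ _ h haB hbB hk ?_ ?_ ?_
    · simp only [rk]; omega
    · simp only [rk]; rw [if_neg (by omega)]; omega
    · simp only [rk]; rw [if_pos (by omega)]; omega
  have hyy : ∀ k l : Fin n, k < l → blk (Tax.y k) ≠ blk (Tax.y l) := by
    intro k l hkl heq
    have hkl' : (k : ℕ) < l := hkl
    have hk : Tax.y k ∈ blk (Tax.y k) := (hblk _).2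
    have hl : Tax.y l ∈ blk (Tax.y k) := heq ▸ (hblk (Tax.y l)).2
    have hneq : blk (Tax.x a) ≠ blk (Tax.y k) := fun h => hyB k (h ▸ hk)
    have hd := hdis _ hBF _ (hblk (Tax.y k)).1 hneq (tr m n l) ⟨⟨l, by omega⟩, rfl⟩
    refine (Set.disjoint_left.1 hd : ∀ ⦃a⦄, _) (a := (Sum.inl (Tax.x b))) ?_ ?_
    · refine cat_span_mem _ _ _ _ haB hbB ?_ ?_ le_rfl
      · intro h
        have := Tax.x.inj h
        omega
      · simp only [rk]; omega
    · refine cat_span_mem _ _ _ _ hk hl ?_ ?_ ?_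
      · intro h
        have := Tax.y.inj h
        omega
      · simp only [rk]; rw [if_pos hkl']; omega
      · simp only [rk]; rw [if_neg (by omega)]; omega
  have hinj : Function.Injective (fun o : Option (Fin n) => match o with
      | none => (⟨blk (Tax.x a), hBF⟩ : F)
      | some k => ⟨blk (Tax.y k), (hblk _).1⟩) := by
    rintro (_ | k) (_ | l) h
    · rfl
    · have h : blk (Tax.x a) = blk (Tax.y l) := congrArg Subtype.val h
      exact absurd (h ▸ (hblk (Tax.y l)).2) (hyB l)
    · have h : blk (Tax.y k) = blk (Tax.x a) := congrArg Subtype.val h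
      exact absurd (h ▸ (hblk (Tax.y k)).2) (hyB k)
    · have h : blk (Tax.y k) = blk (Tax.y l) := congrArg Subtype.val h
      rcases lt_trichotomy k l with h' | h' | h'
      · exact absurd h (hyy k l h')
      · rw [h']
      · exact absurd h.symm (hyy l k h')
  have := Nat.card_le_card_of_injective _ hinj
  rw [Nat.card_coe_set_eq, Nat.card_eq_fintype_card, Fintype.card_option, Fintype.card_fin] at this
  omega

/-- Upper bound after truncating the chain to its first `s` taxa. -/
theorem upper (s : ℕ) (XC : Set (Tax m n))
    (hXC : XC = {a | ¬ ∃ i : Fin m, s ≤ (i : ℕ) ∧ Tax.x i = a}) :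
    ∃ 𝒯C : Set (RTree ↥XC),
      IsRestrictionFamily {T | ∃ i : Fin (n + 1), tr m n i = T} XC 𝒯C ∧
      ∃ F, IsAgreementForest 𝒯C F ∧ F.ncard ≤ s + 1 := by
  have hzX : Tax.z ∈ XC := by
    rw [hXC]
    rintro ⟨i, _, h⟩
    exact absurd h (by simp)
  have hxX : ∀ a : Fin m, Tax.x a ∈ XC → (a : ℕ) < s := by
    intro a ha
    rw [hXC] at ha
    by_contra hcon
    exact ha ⟨a, not_lt.1 hcon, rfl⟩
  have hinj : ∀ i, Function.Injective (fun x : XC => rk i x.1) := fun i =>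
    (rk_inj i).comp Subtype.val_injective
  have hmax : ∀ (i : ℕ) (x : XC), rk i x.1 ≤ rk i (⟨Tax.z, hzX⟩ : XC).1 := fun i x => rk_z i x.1
  let tc : ℕ → RTree XC := fun i => cat (fun x : XC => rk i x.1) (hinj i) ⟨Tax.z, hzX⟩ (hmax i)
  have hres : ∀ i, IsRestrictionOf (tr m n i) XC (tc i) := fun i =>
    cat_restriction (rk i) (rk_inj i) Tax.z (rk_z i) hzX (hinj i) (hmax i)
  let Bz : Set XC := {p | ∀ a, p.1 ≠ Tax.x a}
  have hzB : (⟨Tax.z, hzX⟩ : XC) ∈ Bz := fun a => by simp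
  let S : Set XC := {p | ∃ a, p.1 = Tax.x a}
  have hS : S.ncard ≤ s := by
    have hmem : ∀ p : S, ∃ a : Fin m, p.1.1 = Tax.x a := fun p => p.2
    choose f hf using hmem
    have hg : Function.Injective
        (fun p : S => (⟨f p, hxX _ (hf p ▸ p.1.2)⟩ : Fin s)) := by
      intro p q h
      have h : (f p : ℕ) = f q := congrArg (fun q : Fin s => (q : ℕ)) h
      apply Subtype.ext
      apply Subtype.ext
      rw [hf p, hf q, Fin.ext h]
    have := Nat.card_le_card_of_injective _ hg
    rwa [Nat.card_coe_set_eq, Nat.card_fin] at this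
  refine ⟨{T | ∃ i : Fin (n + 1), tc i = T}, ⟨?_, ?_⟩,
    insert Bz ((fun p => ({p} : Set XC)) '' S), ⟨⟨?_, ?_⟩, ?_, ?_⟩, ?_⟩
  · rintro _ ⟨i, rfl⟩
    exact ⟨_, ⟨i, rfl⟩, hres i⟩
  · rintro _ ⟨i, rfl⟩
    exact ⟨_, ⟨i, rfl⟩, hres i⟩
  · rintro B (rfl | ⟨p, _, rfl⟩)
    · exact ⟨_, hzB⟩
    · exact Set.singleton_nonempty p
  · intro p
    by_cases hp : p ∈ S
    · refine ⟨{p}, ⟨Or.inr ⟨p, hp, rfl⟩, rfl⟩, ?_⟩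
      rintro B ⟨rfl | ⟨q, _, rfl⟩, hpB⟩
      · obtain ⟨a, ha⟩ := hp
        exact absurd ha (hpB a)
      · rw [Set.mem_singleton_iff] at hpB
        rw [hpB]
    · refine ⟨Bz, ⟨Or.inl rfl, fun a ha => hp ⟨a, ha⟩⟩, ?_⟩
      rintro B ⟨rfl | ⟨q, hq, rfl⟩, hpB⟩
      · rfl
      · rw [Set.mem_singleton_iff] at hpB
        exact absurd (hpB ▸ hq) hp
  · rintro B (rfl | ⟨p, _, rfl⟩) _ ⟨i, rfl⟩ _ ⟨j, rfl⟩
    · refine cat_restEq _ _ _ _ _ _ _ hzB ?_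
      rintro ⟨a, ha⟩ ha' ⟨b, hb⟩ hb'
      rcases a with _ | a | a
      · rcases b with _ | b | b
        · simp
        · exact absurd rfl (hb' b)
        · simp only [rk]; split_ifs <;> omega
      · exact absurd rfl (ha' a)
      · rcases b with _ | b | b
        · simp only [rk]; split_ifs <;> omega
        · exact absurd rfl (hb' b)
        · simp only [rk]; split_ifs <;> omega
    · exact cat_restEq_singleton _ _ _ _ _ _ _ p
  · have h1 : ∀ p ∈ S, ∀ i, Disjoint ((tc i).spanSet Bz) ((tc i).spanSet {p}) := by
      intro p hp i
      rw [span_singleton, Set.disjoint_singleton_right]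
      intro h
      obtain ⟨a, ha⟩ := hp
      have hpz : p ≠ ⟨Tax.z, hzX⟩ := by
        rintro rfl
        simp at ha
      change catLabel _ p ∈ _ at h
      rw [catLabel_ne hpz] at h
      exact cat_span_inr _ _ _ _ h a ha
    rintro B (rfl | ⟨p, hp, rfl⟩) B' (rfl | ⟨q, hq, rfl⟩) hne _ ⟨i, rfl⟩
    · exact absurd rfl hne
    · exact h1 q hq i
    · exact (h1 p hp i).symm
    · change Disjoint ((tc i).spanSet {p}) ((tc i).spanSet {q})
      rw [span_singleton, span_singleton, Set.disjoint_singleton]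
      intro h
      exact hne (by rw [(tc i).label_inj h])
  · refine (Set.ncard_insert_le _ _).trans ?_
    have := Set.ncard_image_le (f := fun p => ({p} : Set XC)) (Set.toFinite S)
    omega

end construction

end RTree

/-- **Tightness of the truncation length in `t` (rooted).** For every `t ≥ 3` there
exist a finite taxon set `X`, a set `𝒯` of `t` rooted binary phylogenetic trees on `X`,
and a common `m`-chain `x` of `𝒯` with `m = 2(t+2)`, such that every rooted agreement
forest for `𝒯` has size at least `t`, while the trees obtained by truncating the chain
to length `t−2` (restricting to `X ∖ {x_{t−1}, …, x_m}`) have a rooted agreement forest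
of size at most `t−1`. -/
theorem truncation_to_t_minus_two_not_safe_rooted (t : ℕ) (ht : 3 ≤ t) :
    ∃ (X : Type) (_ : Finite X) (𝒯 : Set (RTree X)) (x : Fin (2 * (t + 2)) → X),
      𝒯.ncard = t ∧ RTree.IsCommonChain 𝒯 x ∧
      (∀ F, RTree.IsAgreementForest 𝒯 F → t ≤ F.ncard) ∧
      ∀ XC : Set X,
        XC = {a : X | ¬ ∃ i : Fin (2 * (t + 2)), t - 2 ≤ (i : ℕ) ∧ x i = a} →
        ∃ 𝒯C : Set (RTree ↥XC), RTree.IsRestrictionFamily 𝒯 XC 𝒯C ∧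
          ∃ F, RTree.IsAgreementForest 𝒯C F ∧ F.ncard ≤ t - 1 := by
  obtain ⟨n, rfl⟩ : ∃ n, t = n + 1 := ⟨t - 1, by omega⟩
  refine ⟨RTree.Tax (2 * (n + 1 + 2)) n, inferInstance,
    {T | ∃ i : Fin (n + 1), RTree.tr _ n i = T}, RTree.Tax.x, ?_, ⟨by omega, ?_, ?_⟩, ?_, ?_⟩
  · have hinj : Function.Injective
        (fun i : Fin (n + 1) => RTree.tr (2 * (n + 1 + 2)) n i) := by
      intro i j h
      rcases lt_trichotomy i j with h' | h' | h'
      · exact absurd h (RTree.tr_ne h' (by omega) (by omega))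
      · exact h'
      · exact absurd h.symm (RTree.tr_ne h' (by omega) (by omega))
    have h := Set.ncard_image_of_injective (Set.univ : Set (Fin (n + 1))) hinj
    rw [Set.image_univ, Set.ncard_univ, Nat.card_fin] at h
    exact h
  · intro a b h
    exact RTree.Tax.x.inj h
  · rintro _ ⟨i, rfl⟩
    exact RTree.tr_chain i
  · intro F hF
    exact RTree.lower (by omega) F hF
  · intro XC hXC
    obtain ⟨𝒯C, h1, F, h2, h3⟩ := RTree.upper (n + 1 - 2) XC hXC
    exact ⟨𝒯C, h1, F, h2, by omega⟩
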